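/- Let A be a (not necessarily commutative) ring. If every cyclic right module over the Laurent series ring R = A((x)) is quotient finite-dimensional (in particular, if R is a right serial ring), then R is a right Noetherian ring. -/

import Mathlib

/-- A module is *uniserial* if any two of its submodules are comparable with
respect to inclusion. -/
def IsUniserialModule (R M : Type*) [Ring R] [AddCommGroup M] [Module R M] : Prop :=
  ∀ N₁ N₂ : Submodule R M, N₁ ≤ N₂ ∨ N₂ ≤ N₁

/-- A ring `A` is *right serial* if `A` is a finite direct sum of uniserial right
ideals, i.e. the right module `A_A` is a serial module.  Right ideals of `A` are
the submodules of `A` viewed as a right module over itself, i.e. as a module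
over the opposite ring `Aᵐᵒᵖ`. -/
def IsRightSerialRing (A : Type*) [Ring A] : Prop :=
  ∃ (ι : Type) (_ : Fintype ι) (N : ι → Submodule Aᵐᵒᵖ A),
    iSupIndep N ∧ (⨆ i, N i) = ⊤ ∧ ∀ i, IsUniserialModule Aᵐᵒᵖ (N i)

/-- A ring `A` is *left serial* if `A` is a finite direct sum of uniserial left
ideals, i.e. the left module `_AA` is a serial module. -/
def IsLeftSerialRing (A : Type*) [Ring A] : Prop :=
  ∃ (ι : Type) (_ : Fintype ι) (N : ι → Submodule A A),
    iSupIndep N ∧ (⨆ i, N i) = ⊤ ∧ ∀ i, IsUniserialModule A (N i)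

/-- A module `M` is *finite-dimensional* if it contains no infinite direct sum of
nonzero submodules, i.e. there is no infinite independent family of nonzero
submodules of `M`. -/
def IsFinDimModule (R M : Type*) [Ring R] [AddCommGroup M] [Module R M] : Prop :=
  ¬ ∃ (ι : Type) (_ : Infinite ι) (N : ι → Submodule R M),
      (∀ i, N i ≠ ⊥) ∧ iSupIndep N

/-- A module `M` is *quotient finite-dimensional* if every factor module of `M`
is finite-dimensional. -/
def IsQFDModule (R M : Type*) [Ring R] [AddCommGroup M] [Module R M] : Prop :=
  ∀ N : Submodule R M, IsFinDimModule R (M ⧸ N)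

universe u

/-- If each `f i` lies in every `K j` with `j ≠ i` but not in `K i`, then the images of the `f i`
generate an infinite direct sum in the quotient by `⨅ i, K i`. -/
theorem not_isFinDimModule_quotient_iInf {R M : Type*} [Ring R] [AddCommGroup M] [Module R M]
    {ι : Type} [Infinite ι] (f : ι → M) (K : ι → Submodule R M)
    (hmem : ∀ i j, i ≠ j → f i ∈ K j) (hnot : ∀ i, f i ∉ K i) :
    ¬ IsFinDimModule R (M ⧸ ⨅ i, K i) := by
  have hker : ∀ i, LinearMap.ker (⨅ i, K i).mkQ ≤ K i := fun i ↦ by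
    rw [Submodule.ker_mkQ]; exact iInf_le K i
  have hcomap : ∀ i y, (⨅ i, K i).mkQ y ∈ (K i).map (⨅ i, K i).mkQ → y ∈ K i := by
    intro i y hy
    rwa [← Submodule.mem_comap, Submodule.comap_map_eq_self (hker i)] at hy
  refine not_not.mpr ⟨ι, inferInstance,
    fun i ↦ Submodule.span R {(⨅ i, K i).mkQ (f i)}, fun i ↦ ?_, fun i ↦ ?_⟩
  · rw [Ne, Submodule.span_singleton_eq_bot, Submodule.mkQ_apply, Submodule.Quotient.mk_eq_zero]
    exact fun hi ↦ hnot i (iInf_le K i hi)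
  · rw [Submodule.disjoint_def]
    intro x hx hx'
    obtain ⟨r, rfl⟩ := Submodule.mem_span_singleton.mp hx
    have hle : ⨆ j, ⨆ (_ : j ≠ i), Submodule.span R {(⨅ i, K i).mkQ (f j)} ≤
        (K i).map (⨅ i, K i).mkQ := by
      refine iSup₂_le fun j hj ↦ ?_
      rw [Submodule.span_singleton_le_iff_mem]
      exact Submodule.mem_map_of_mem (hmem j i hj)
    rw [← map_smul, Submodule.mkQ_apply, Submodule.Quotient.mk_eq_zero, Submodule.mem_iInf]
    intro j
    by_cases hj : i = j
    · subst hj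
      have := hle hx'
      rw [← map_smul] at this
      exact hcomap _ _ this
    · exact (K j).smul_mem r (hmem i j hj)

namespace LaurentSeries

variable {A : Type*} [Ring A]

/-- The Laurent series whose coefficients, up to any fixed shift `c`, at degrees at most `m ^ 2 + c`
eventually lie in `B m` as `m` runs over the set `S`. -/
def slowGrowth (B : ℕ → Submodule Aᵐᵒᵖ A) (S : Set ℕ) :
    Submodule (LaurentSeries A)ᵐᵒᵖ (LaurentSeries A) where
  carrier := {g | ∀ c : ℤ, ∃ n : ℕ, ∀ m ∈ S, n ≤ m → ∀ l : ℤ, l ≤ (m : ℤ) ^ 2 + c →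
    g.coeff l ∈ B m}
  add_mem' {f g} hf hg c := by
    obtain ⟨n₁, h₁⟩ := hf c
    obtain ⟨n₂, h₂⟩ := hg c
    refine ⟨max n₁ n₂, fun m hm hnm l hl ↦ ?_⟩
    rw [HahnSeries.coeff_add]
    exact add_mem (h₁ m hm (le_of_max_le_left hnm) l hl) (h₂ m hm (le_of_max_le_right hnm) l hl)
  zero_mem' c := ⟨0, fun m _ _ l _ ↦ by simp⟩
  smul_mem' r g hg c := by
    obtain ⟨n, hn⟩ := hg (c - r.unop.order)
    refine ⟨n, fun m hm hnm l hl ↦ ?_⟩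
    rw [MulOpposite.smul_eq_mul_unop, HahnSeries.coeff_mul]
    refine sum_mem fun ij hij ↦ ?_
    rw [Finset.mem_antidiagonal] at hij
    have hord := HahnSeries.order_le_of_coeff_ne_zero hij.2.1
    exact (B m).smul_mem (MulOpposite.op (r.unop.coeff ij.2))
      (hn m hm hnm ij.1 (by linarith [hij.2.2]))

theorem coeff_ofPowerSeries_of_neg (p : PowerSeries A) {k : ℤ} (hk : k < 0) :
    (HahnSeries.ofPowerSeries ℤ A p).coeff k = 0 := by
  rw [HahnSeries.ofPowerSeries_apply]
  exact HahnSeries.embDomain_of_notMem_range (by rintro ⟨n, rfl⟩; simp at hk; omega)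

/-- If the ring of Laurent series is quotient finite-dimensional as a right module over itself, then
the coefficient ring is right Noetherian. -/
theorem isNoetherian_coeff_of_isQFDModule
    (h : IsQFDModule (LaurentSeries A)ᵐᵒᵖ (LaurentSeries A)) : IsNoetherian Aᵐᵒᵖ A := by
  rw [← monotone_stabilizes_iff_noetherian]
  by_contra! hstab
  obtain ⟨F, hF⟩ := hstab
  have hstep : ∀ n, ∃ m, n < m ∧ F n < F m := fun n ↦ by
    obtain ⟨m, hnm, hne⟩ := hF n
    exact ⟨m, lt_of_le_of_ne hnm fun e ↦ hne (e ▸ rfl), lt_of_le_of_ne (F.monotone hnm) hne⟩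
  choose next _ hnext using hstep
  let B : ℕ → Submodule Aᵐᵒᵖ A := fun n ↦ F (next^[n] 0)
  have hB : ∀ n, B n < B (n + 1) := fun n ↦ by
    simp only [B, Function.iterate_succ_apply']
    exact hnext _
  have hmono : Monotone B := monotone_nat_of_le_succ fun n ↦ (hB n).le
  choose a ha ha' using fun n ↦ SetLike.exists_of_lt (hB n)
  classical
  let f : ℕ → LaurentSeries A := fun i ↦ HahnSeries.ofPowerSeries ℤ A
    (PowerSeries.mk fun n ↦ if n.sqrt ^ 2 = n ∧ n.sqrt.unpair.1 = i then a n.sqrt else 0)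
  let S : ℕ → Set ℕ := fun j ↦ {m | m.unpair.1 = j}
  refine not_isFinDimModule_quotient_iInf f (fun j ↦ slowGrowth B (S j)) ?_ ?_ (h _)
  · intro i j hij c
    refine ⟨c.toNat, fun m hm hcm l hl ↦ ?_⟩
    obtain ⟨n, rfl⟩ | hneg : (∃ n : ℕ, (n : ℤ) = l) ∨ l < 0 := by
      rcases lt_or_ge l 0 with hl0 | hl0
      · exact Or.inr hl0
      · exact Or.inl ⟨l.toNat, Int.toNat_of_nonneg hl0⟩
    · simp only [f, HahnSeries.ofPowerSeries_apply_coeff, PowerSeries.coeff_mk]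
      split_ifs with hn
      · have hlt : n.sqrt < m + 1 := by
          rw [Nat.sqrt_lt]
          zify
          have : c ≤ m := by omega
          nlinarith
        have hne : n.sqrt ≠ m := by
          intro e
          rw [e] at hn
          exact hij (hn.2.symm.trans hm)
        exact hmono (show n.sqrt + 1 ≤ m by omega) (ha _)
      · exact zero_mem _
    · rw [coeff_ofPowerSeries_of_neg _ hneg]
      exact zero_mem _
  · intro i hi
    obtain ⟨n, hn⟩ := hi 0
    have := hn (Nat.pair i n) (by simp [S]) (Nat.right_le_pair i n)
      ((Nat.pair i n ^ 2 : ℕ) : ℤ) (by simp)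
    simp only [f, HahnSeries.ofPowerSeries_apply_coeff, PowerSeries.coeff_mk, Nat.sqrt_eq',
      Nat.unpair_pair, and_self, if_true] at this
    exact ha' _ this

/-- The right ideal of constant coefficients of the elements of `I` without negative terms. -/
def constCoeffIdeal (I : Submodule (LaurentSeries A)ᵐᵒᵖ (LaurentSeries A)) : Submodule Aᵐᵒᵖ A where
  carrier := {a | ∃ g ∈ I, (∀ k < 0, g.coeff k = 0) ∧ g.coeff 0 = a}
  add_mem' := by
    rintro _ _ ⟨f, hf, hf', rfl⟩ ⟨g, hg, hg', rfl⟩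
    exact ⟨f + g, add_mem hf hg, fun k hk ↦ by simp [hf' k hk, hg' k hk], by simp⟩
  zero_mem' := ⟨0, zero_mem _, by simp, by simp⟩
  smul_mem' := by
    rintro r _ ⟨g, hg, hg', rfl⟩
    refine ⟨g * HahnSeries.C r.unop, I.smul_mem (MulOpposite.op _) hg, fun k hk ↦ ?_, ?_⟩
    · simp [HahnSeries.C_apply, hg' k hk]
    · simp [HahnSeries.C_apply]

theorem eq_zero_of_forall_eq_single_mul (D : ℕ → LaurentSeries A)
    (hD : ∀ n, D n = HahnSeries.single 1 1 * D (n + 1)) (hneg : ∀ n, ∀ k < 0, (D n).coeff k = 0) :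
    D 0 = 0 := by
  have key : ∀ (n m : ℕ) (k : ℤ), k < n → (D m).coeff k = 0 := by
    intro n
    induction n with
    | zero => exact fun m k hk ↦ hneg m k (by simpa using hk)
    | succ n ih =>
      intro m k hk
      rw [hD, HahnSeries.coeff_single_mul, one_mul]
      exact ih _ _ (by push_cast at hk; linarith)
  ext k
  exact key (k.toNat + 1) 0 k (by omega)

theorem coeff_mul_eq_zero_of_neg {f g : LaurentSeries A} (hf : ∀ k < 0, f.coeff k = 0)
    (hg : ∀ k < 0, g.coeff k = 0) {k : ℤ} (hk : k < 0) : (f * g).coeff k = 0 := by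
  rw [HahnSeries.coeff_mul]
  refine Finset.sum_eq_zero fun ij hij ↦ ?_
  rw [Finset.mem_antidiagonal] at hij
  rcases lt_or_ge ij.1 0 with h | h
  · rw [hf _ h, zero_mul]
  · rw [hg ij.2 (by linarith [hij.2.2]), mul_zero]

theorem ofPowerSeries_mk_eq_add (c : ℕ → A) :
    HahnSeries.ofPowerSeries ℤ A (PowerSeries.mk c) = HahnSeries.C (c 0) +
      HahnSeries.single 1 1 * HahnSeries.ofPowerSeries ℤ A (PowerSeries.mk fun n ↦ c (n + 1)) := by
  rw [← HahnSeries.ofPowerSeries_C, ← HahnSeries.ofPowerSeries_X, ← map_mul, ← map_add]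
  congr 1
  ext n
  cases n with
  | zero => simp
  | succ n => simp [PowerSeries.coeff_succ_X_mul]

theorem single_one_mul_comm (g : LaurentSeries A) (n : ℤ) :
    HahnSeries.single n 1 * g = g * HahnSeries.single n 1 := by
  ext k
  simp [HahnSeries.coeff_single_mul, HahnSeries.coeff_mul_single]

/-- Hilbert's basis theorem for Laurent series: if the coefficient ring is right Noetherian, then
so is the ring of Laurent series. -/
theorem isNoetherian_of_isNoetherian_coeff [IsNoetherian Aᵐᵒᵖ A] :
    IsNoetherian (LaurentSeries A)ᵐᵒᵖ (LaurentSeries A) := by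
  refine ⟨fun I ↦ ?_⟩
  obtain ⟨d, a, ha⟩ := Submodule.fg_iff_exists_fin_generating_family.mp
    (IsNoetherian.noetherian (constCoeffIdeal I))
  have hmem : ∀ i, a i ∈ constCoeffIdeal I := fun i ↦
    ha ▸ Submodule.subset_span (Set.mem_range_self i)
  choose f hfI hfneg hf0 using hmem
  let P : Type _ := {g : LaurentSeries A // g ∈ I ∧ ∀ k < 0, g.coeff k = 0}
  have hstep : ∀ g : P, ∃ (c : Fin d → A) (g' : P),
      g.1 = ∑ i, f i * HahnSeries.C (c i) + HahnSeries.single 1 1 * g'.1 := by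
    rintro ⟨g, hgI, hg⟩
    have h0 : g.coeff 0 ∈ Submodule.span Aᵐᵒᵖ (Set.range a) := ha ▸ ⟨g, hgI, hg, rfl⟩
    obtain ⟨c, hc⟩ := (Submodule.mem_span_range_iff_exists_fun _).mp h0
    have hrI : g - ∑ i, f i * HahnSeries.C (c i).unop ∈ I :=
      sub_mem hgI (sum_mem fun i _ ↦ I.smul_mem (MulOpposite.op _) (hfI i))
    refine ⟨fun i ↦ (c i).unop, ⟨(g - ∑ i, f i * HahnSeries.C (c i).unop) *
      HahnSeries.single (-1) 1, I.smul_mem (MulOpposite.op _) hrI, fun k hk ↦ ?_⟩, ?_⟩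
    · rw [HahnSeries.coeff_mul_single, mul_one, HahnSeries.coeff_sub, HahnSeries.coeff_sum]
      simp only [HahnSeries.C_apply, HahnSeries.coeff_mul_single_zero]
      rcases lt_or_eq_of_le (show k - -1 ≤ 0 by omega) with hk' | hk'
      · rw [hg _ hk', Finset.sum_eq_zero fun i _ ↦ by rw [hfneg i _ hk', zero_mul], sub_zero]
      · rw [hk', ← hc, sub_eq_zero]
        simp [hf0, MulOpposite.smul_eq_mul_unop]
    · simp only
      rw [single_one_mul_comm, mul_assoc, HahnSeries.single_mul_single]
      simp [← HahnSeries.C_apply]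
  choose c g' hg' using hstep
  have hexp : ∀ g : P, g.1 ∈ Submodule.span (LaurentSeries A)ᵐᵒᵖ (Set.range f) := by
    intro g
    let G : ℕ → P := fun n ↦ g'^[n] g
    let r : ℕ → Fin d → LaurentSeries A := fun n i ↦
      HahnSeries.ofPowerSeries ℤ A (PowerSeries.mk fun m ↦ c (G (n + m)) i)
    have hr : ∀ n i, r n i = HahnSeries.C (c (G n) i) + HahnSeries.single 1 1 * r (n + 1) i := by
      intro n i
      simp only [r]
      rw [ofPowerSeries_mk_eq_add]
      simp only [add_zero, add_assoc, add_comm 1]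
    have hG : ∀ n, (G n).1 = ∑ i, f i * HahnSeries.C (c (G n) i) +
        HahnSeries.single 1 1 * (G (n + 1)).1 := by
      intro n
      simp only [G, Function.iterate_succ_apply']
      exact hg' _
    have hzero := eq_zero_of_forall_eq_single_mul (fun n ↦ (G n).1 - ∑ i, f i * r n i)
      (fun n ↦ by
        simp only [hr n, mul_add, Finset.sum_add_distrib]
        rw [hG n, mul_sub, Finset.mul_sum]
        simp only [← mul_assoc, single_one_mul_comm (f _)]
        abel)
      (fun n k hk ↦ by
        rw [HahnSeries.coeff_sub, HahnSeries.coeff_sum, (G n).2.2 k hk,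
          Finset.sum_eq_zero fun i _ ↦ coeff_mul_eq_zero_of_neg (hfneg i)
            (fun k hk ↦ coeff_ofPowerSeries_of_neg _ hk) hk, sub_zero])
    rw [show g.1 = ∑ i, f i * r 0 i from sub_eq_zero.mp hzero]
    exact sum_mem fun i _ ↦ Submodule.smul_mem _ (MulOpposite.op _)
      (Submodule.subset_span (Set.mem_range_self i))
  refine Submodule.fg_iff_exists_fin_generating_family.mpr ⟨d, f, le_antisymm ?_ fun g hg ↦ ?_⟩
  · rw [Submodule.span_le]
    rintro _ ⟨i, rfl⟩
    exact hfI i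
  · have := hexp ⟨g * HahnSeries.single (-g.order) 1, I.smul_mem (MulOpposite.op _) hg,
      fun k hk ↦ by
        rw [HahnSeries.coeff_mul_single, mul_one]
        exact HahnSeries.coeff_eq_zero_of_lt_order (by linarith)⟩
    have := Submodule.smul_mem _ (MulOpposite.op (HahnSeries.single g.order (1 : A))) this
    simpa [MulOpposite.smul_eq_mul_unop, mul_assoc, HahnSeries.single_mul_single] using this

end LaurentSeries

/-- If every cyclic right module over the Laurent series ring `R = A((x))` is
quotient finite-dimensional, then `R` is a right Noetherian ring. -/
theorem laurentSeries_rightNoetherian_of_cyclic_qfd (A : Type u) [Ring A]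
    (h : ∀ (M : Type u) [AddCommGroup M] [Module (LaurentSeries A)ᵐᵒᵖ M],
      (∃ m : M, Submodule.span (LaurentSeries A)ᵐᵒᵖ {m} = ⊤) →
        IsQFDModule (LaurentSeries A)ᵐᵒᵖ M) :
    IsNoetherian (LaurentSeries A)ᵐᵒᵖ (LaurentSeries A) := by
  have hqfd : IsQFDModule (LaurentSeries A)ᵐᵒᵖ (LaurentSeries A) :=
    h _ ⟨1, Submodule.eq_top_iff'.mpr fun r ↦
      Submodule.mem_span_singleton.mpr ⟨MulOpposite.op r, by simp⟩⟩
  have := LaurentSeries.isNoetherian_coeff_of_isQFDModule hqfd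
  exact LaurentSeries.isNoetherian_of_isNoetherian_coeff
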